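/- arXiv:2205.13409 — 10 statements merged into one kernel-verified Lean document; each statement's English description precedes it below -/
import Mathlib

section
/- Let n, m, d ∈ ℕ, let U be a nonempty subset of ℝ^m, let f : ℝⁿ × U → ℝⁿ and σ : ℝⁿ × U → ℝ^{n×d} (real n×d matrices), and let Z̄ ≥ 0. Suppose there exist nondecreasing, upper semicontinuous functions f̄, σ̄ : [0,∞) → [0,∞) such that ‖f(x,u)‖ ≤ f̄(‖x‖) and ‖σ(x,u)‖_op ≤ σ̄(‖x‖) for all x ∈ ℝⁿ and u ∈ U, where ‖·‖_op is the operator norm and ‖·‖ the Euclidean norm. Then there exists a nonnegative, locally Lipschitz continuous function ρ : [0,∞) → [0,∞) such that for all x ∈ ℝⁿ and u ∈ U: ⟨x, f(x,u)⟩ + ‖σ(x,u)ᵀ x‖ · Z̄ ≤ ρ(‖x‖) · ‖x‖. -/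
open scoped NNReal RealInnerProductSpace

/-- A monotone function on `[0, ∞)` is dominated by a locally Lipschitz one. -/
theorem Monotone.exists_locallyLipschitz_ge {g : ℝ≥0 → ℝ≥0} (hg : Monotone g) :
    ∃ ρ : ℝ≥0 → ℝ≥0, LocallyLipschitz ρ ∧ ∀ r, g r ≤ ρ r := by
  obtain ⟨h, hh⟩ := exists_contMDiffMap_forall_mem_convex_of_local_const (modelWithCornersSelf ℝ ℝ) (n := 1)
    (t := fun x : ℝ => Set.Ici (g x.toNNReal : ℝ)) (fun x => convex_Ici _) (fun x => by
      refine ⟨g (x + 1).toNNReal, ?_⟩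
      filter_upwards [Iio_mem_nhds (lt_add_one x)] with y hy
      exact NNReal.coe_le_coe.2 (hg (Real.toNNReal_le_toNNReal (le_of_lt hy))))
  have hLip : LocallyLipschitz h :=
    h.contMDiff.contDiff.locallyLipschitz
  refine ⟨fun r => (h r).toNNReal, ?_, fun r => ?_⟩
  · have hcoe : LipschitzWith 1 ((↑) : ℝ≥0 → ℝ) := LipschitzWith.subtype_val _
    exact Real.lipschitzWith_toNNReal.locallyLipschitz.comp (hLip.comp hcoe.locallyLipschitz)
  · have := hh r
    simp only [Real.toNNReal_coe, Set.mem_Ici] at this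
    exact NNReal.le_toNNReal_of_coe_le this

/-- Existence of a radial growth bound: if `‖f(x,u)‖ ≤ f̄(‖x‖)` and
`‖σ(x,u)‖_op ≤ σ̄(‖x‖)` for nondecreasing upper semicontinuous `f̄, σ̄ : [0,∞) → [0,∞)`,
then there is a nonnegative locally Lipschitz `ρ : [0,∞) → [0,∞)` with
`⟨x, f(x,u)⟩ + ‖σ(x,u)ᵀ x‖ · Z̄ ≤ ρ(‖x‖) ‖x‖` for all `x` and all `u ∈ U`. -/
theorem radial_growth_bound_exists (n m d : ℕ)
    (U : Set (EuclideanSpace ℝ (Fin m))) (hU : U.Nonempty)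
    (f : EuclideanSpace ℝ (Fin n) → EuclideanSpace ℝ (Fin m) → EuclideanSpace ℝ (Fin n))
    (σ : EuclideanSpace ℝ (Fin n) → EuclideanSpace ℝ (Fin m) →
      (EuclideanSpace ℝ (Fin d) →L[ℝ] EuclideanSpace ℝ (Fin n)))
    (Z : ℝ) (hZ : 0 ≤ Z)
    (fbar σbar : ℝ≥0 → ℝ≥0)
    (hfbarMono : Monotone fbar) (hσbarMono : Monotone σbar)
    (hfbarUsc : UpperSemicontinuous fbar) (hσbarUsc : UpperSemicontinuous σbar)
    (hfbar : ∀ x, ∀ u ∈ U, ‖f x u‖₊ ≤ fbar ‖x‖₊)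
    (hσbar : ∀ x, ∀ u ∈ U, ‖σ x u‖₊ ≤ σbar ‖x‖₊) :
    ∃ ρ : ℝ≥0 → ℝ≥0, LocallyLipschitz ρ ∧
      ∀ x, ∀ u ∈ U,
        ⟪x, f x u⟫ + ‖(ContinuousLinearMap.adjoint (σ x u)) x‖ * Z ≤ (ρ ‖x‖₊ : ℝ) * ‖x‖ := by
  obtain ⟨ρ, hρ, hle⟩ := Monotone.exists_locallyLipschitz_ge
    (g := fun r => fbar r + σbar r * Z.toNNReal)
    (fun a b hab => add_le_add (hfbarMono hab) (mul_le_mul_left (hσbarMono hab) _))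
  refine ⟨ρ, hρ, fun x u hu => ?_⟩
  have hf : ‖f x u‖ ≤ fbar ‖x‖₊ := hfbar x u hu
  have hσ : ‖σ x u‖ ≤ σbar ‖x‖₊ := hσbar x u hu
  have hsum : (fbar ‖x‖₊ : ℝ) + σbar ‖x‖₊ * Z ≤ ρ ‖x‖₊ := by
    simpa [hZ] using NNReal.coe_le_coe.2 (hle ‖x‖₊)
  have hadj : ‖(ContinuousLinearMap.adjoint (σ x u)) x‖ ≤ ‖σ x u‖ * ‖x‖ := by
    simpa using (ContinuousLinearMap.adjoint (σ x u)).le_opNorm x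
  calc ⟪x, f x u⟫ + ‖(ContinuousLinearMap.adjoint (σ x u)) x‖ * Z
      ≤ ‖x‖ * ‖f x u‖ + ‖σ x u‖ * ‖x‖ * Z := by
        gcongr
        exact real_inner_le_norm x (f x u)
    _ ≤ ‖x‖ * fbar ‖x‖₊ + σbar ‖x‖₊ * ‖x‖ * Z := by gcongr
    _ = (fbar ‖x‖₊ + σbar ‖x‖₊ * Z) * ‖x‖ := by ring
    _ ≤ ρ ‖x‖₊ * ‖x‖ := by gcongr
end

section
/- Let ρ : ℝ → ℝ be locally Lipschitz continuous and nonnegative, let t₁ ≤ t₂ be reals, let y : [t₁, t₂] → ℝ be continuous and satisfy y(t) = y(t₁) + ∫_{t₁}^{t} ρ(y(τ)) dτ for all t ∈ [t₁, t₂], and let h : [t₁, t₂] → ℝ be continuous and satisfy h(t) ≤ h(s) + ∫_{s}^{t} ρ(h(τ)) dτ for all t₁ ≤ s ≤ t ≤ t₂. If h(t₁) ≤ y(t₁), then h(t) ≤ y(t) for all t ∈ [t₁, t₂]. -/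
open intervalIntegral

open Set Filter Topology in
/-- An integral bound on the increments of `f` bounds its upper right Dini derivative. -/
lemma eventually_slope_lt_of_le_add_integral {f u : ℝ → ℝ} {a b : ℝ}
    (hu : ContinuousOn u (Icc a b))
    (hfu : ∀ s t : ℝ, a ≤ s → s ≤ t → t ≤ b → f t ≤ f s + ∫ τ in s..t, u τ)
    {x : ℝ} (hx : x ∈ Ico a b) {r : ℝ} (hr : u x < r) :
    ∀ᶠ z in 𝓝[>] x, slope f x z < r := by
  have hIcc : Icc a b ∈ 𝓝[>] x := Icc_mem_nhdsGT_of_mem hx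
  have hderiv : HasDerivWithinAt (fun z => ∫ τ in x..z, u τ) (u x) (Ici x) x :=
    integral_hasDerivWithinAt_right (by simp)
      (⟨Icc a b, hIcc, hu.aestronglyMeasurable measurableSet_Icc⟩)
      ((hu x (Ico_subset_Icc_self hx)).mono_of_mem_nhdsWithin hIcc)
  have hslope := (hasDerivWithinAt_iff_tendsto_slope' self_notMem_Ioi).1 hderiv.Ioi_of_Ici
  filter_upwards [hslope.eventually_lt_const hr, hIcc, self_mem_nhdsWithin] with z hz hzab hxz
  refine lt_of_le_of_lt ?_ hz
  have hxz' : x < z := hxz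
  have hinc := hfu x z hx.1 hxz'.le hzab.2
  rw [slope_def_field, slope_def_field, integral_same, sub_zero]
  exact div_le_div_of_nonneg_right (by linarith) (sub_pos.2 hxz').le

open Set in
/-- A one-sided integral Grönwall inequality: the linear bound on `u` is only needed where
`f` is positive. -/
lemma nonpos_of_le_add_integral {f u : ℝ → ℝ} {a b K : ℝ}
    (hf : ContinuousOn f (Icc a b)) (hu : ContinuousOn u (Icc a b))
    (hfu : ∀ s t : ℝ, a ≤ s → s ≤ t → t ≤ b → f t ≤ f s + ∫ τ in s..t, u τ)
    (ha : f a ≤ 0) (bound : ∀ t ∈ Icc a b, 0 < f t → u t ≤ K * f t) :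
    ∀ t ∈ Icc a b, f t ≤ 0 := by
  intro t ht
  have key : ∀ ε : ℝ, 0 < ε → f t ≤ ε * Real.exp ((K + 1) * (t - a)) := by
    intro ε hε
    refine image_le_of_liminf_slope_right_lt_deriv_boundary hf
      (fun x hx r hr => (eventually_slope_lt_of_le_add_integral hu hfu hx hr).frequently)
      (B := fun x => ε * Real.exp ((K + 1) * (x - a)))
      (B' := fun x => (K + 1) * (ε * Real.exp ((K + 1) * (x - a)))) ?_ ?_ ?_ ht
    · simpa using ha.trans hε.le
    · intro x
      convert! ((((hasDerivAt_id x).sub_const a).const_mul (K + 1)).exp).const_mul ε using 1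
      simp only [id_eq]
      ring
    · intro x hx hxB
      have hpos : 0 < f x := hxB ▸ by positivity
      have := bound x (Ico_subset_Icc_self hx) hpos
      rw [← hxB]
      linarith
  refine le_of_forall_pos_le_add fun ε hε => ?_
  have := key (ε / Real.exp ((K + 1) * (t - a))) (by positivity)
  rw [div_mul_cancel₀ _ (Real.exp_ne_zero _)] at this
  linarith

/-- Comparison (Grönwall-type) lemma: a continuous function `h` satisfying the
integral inequality `h(t) ≤ h(s) + ∫_s^t ρ(h(τ)) dτ` is dominated on `[t₁, t₂]` by the solution
`y` of `y(t) = y(t₁) + ∫_{t₁}^t ρ(y(τ)) dτ`, provided `h(t₁) ≤ y(t₁)`, where `ρ` is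
nonnegative and locally Lipschitz. -/
theorem radial_forecast_comparison (ρ : ℝ → ℝ) (hρLip : LocallyLipschitz ρ)
    (hρ0 : ∀ s, 0 ≤ ρ s) (t₁ t₂ : ℝ) (ht : t₁ ≤ t₂) (y h : ℝ → ℝ)
    (hyCont : ContinuousOn y (Set.Icc t₁ t₂))
    (hyInt : ∀ t ∈ Set.Icc t₁ t₂, y t = y t₁ + ∫ τ in t₁..t, ρ (y τ))
    (hhCont : ContinuousOn h (Set.Icc t₁ t₂))
    (hhInt : ∀ s t : ℝ, t₁ ≤ s → s ≤ t → t ≤ t₂ → h t ≤ h s + ∫ τ in s..t, ρ (h τ))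
    (hinit : h t₁ ≤ y t₁) :
    ∀ t ∈ Set.Icc t₁ t₂, h t ≤ y t := by
  have hρh : ContinuousOn (fun t => ρ (h t)) (Set.Icc t₁ t₂) :=
    hρLip.continuous.comp_continuousOn hhCont
  have hρy : ContinuousOn (fun t => ρ (y t)) (Set.Icc t₁ t₂) :=
    hρLip.continuous.comp_continuousOn hyCont
  obtain ⟨K, hK⟩ := LocallyLipschitzOn.exists_lipschitzOnWith_of_compact
    ((isCompact_Icc.image_of_continuousOn hhCont).union
      (isCompact_Icc.image_of_continuousOn hyCont)) hρLip.locallyLipschitzOn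
  have hint : ∀ {g : ℝ → ℝ}, ContinuousOn g (Set.Icc t₁ t₂) → ∀ {s t : ℝ}, t₁ ≤ s → s ≤ t →
      t ≤ t₂ → IntervalIntegrable g MeasureTheory.volume s t := fun hg s t hs hst ht' =>
    (hg.mono (Set.Icc_subset_Icc hs ht')).intervalIntegrable_of_Icc hst
  have hnonpos := nonpos_of_le_add_integral (K := K) (hhCont.sub hyCont) (hρh.sub hρy)
    (fun s t hs hst ht' => by
      have hadd := integral_add_adjacent_intervals (hint hρy le_rfl hs (hst.trans ht'))
        (hint hρy hs hst ht')
      have hsub := integral_sub (hint hρh hs hst ht') (hint hρy hs hst ht')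
      have hys := hyInt s ⟨hs, hst.trans ht'⟩
      have hyt := hyInt t ⟨hs.trans hst, ht'⟩
      have hht := hhInt s t hs hst ht'
      simp only [Pi.sub_apply]
      linarith)
    (sub_nonpos.2 hinit)
    (fun t ht' hpos => by
      have hdist := hK.dist_le_mul (h t) (Or.inl ⟨t, ht', rfl⟩) (y t) (Or.inr ⟨t, ht', rfl⟩)
      rw [Real.dist_eq, Real.dist_eq, abs_of_pos (a := h t - y t) hpos] at hdist
      exact (le_abs_self _).trans hdist)
  exact fun t ht' => sub_nonpos.1 (hnonpos t ht')
end

section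
/- Let n ∈ ℕ, λ > 0, and let α₁, α₂ be class-𝒦∞ functions. Let L : ℝⁿ → ℝ satisfy α₁(‖x‖) ≤ L(x) ≤ α₂(‖x‖) for all x ∈ ℝⁿ, and define L_λ(x) := inf_{y ∈ ℝⁿ} (L(y) + ‖y − x‖²/(2λ²)). Then L_λ is positive definite: L_λ(0) = 0 and L_λ(x) > 0 for every x ≠ 0. -/
/-- A function `α : [0,∞) → [0,∞)` of class `𝒦∞`: continuous, strictly increasing,
`α(0) = 0`, and `α(s) → ∞` as `s → ∞`. -/
def IsKInfty (α : ℝ → ℝ) : Prop :=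
  ContinuousOn α (Set.Ici 0) ∧ StrictMonoOn α (Set.Ici 0) ∧ α 0 = 0 ∧
    Filter.Tendsto α Filter.atTop Filter.atTop

theorem IsKInfty.nonneg {α : ℝ → ℝ} (hα : IsKInfty α) {s : ℝ} (hs : 0 ≤ s) : 0 ≤ α s :=
  hα.2.2.1 ▸ hα.2.1.monotoneOn Set.self_mem_Ici hs hs

theorem IsKInfty.pos {α : ℝ → ℝ} (hα : IsKInfty α) {s : ℝ} (hs : 0 < s) : 0 < α s :=
  hα.2.2.1 ▸ hα.2.1 Set.self_mem_Ici hs.le hs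

/-- The Moreau envelope `L_λ(x) = inf_y (L(y) + ‖y − x‖²/(2λ²))` of a
function sandwiched between two `𝒦∞` functions of the norm is positive definite. -/
theorem moreau_envelope_pos_def (n : ℕ) (lam : ℝ) (hlam : 0 < lam) (α₁ α₂ : ℝ → ℝ)
    (hα₁ : IsKInfty α₁) (hα₂ : IsKInfty α₂)
    (L : EuclideanSpace ℝ (Fin n) → ℝ)
    (hL : ∀ x, α₁ ‖x‖ ≤ L x ∧ L x ≤ α₂ ‖x‖) :
    (⨅ y : EuclideanSpace ℝ (Fin n),
        (L y + ‖y - (0 : EuclideanSpace ℝ (Fin n))‖ ^ 2 / (2 * lam ^ 2))) = 0 ∧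
    ∀ x : EuclideanSpace ℝ (Fin n), x ≠ 0 →
      0 < ⨅ y : EuclideanSpace ℝ (Fin n), (L y + ‖y - x‖ ^ 2 / (2 * lam ^ 2)) := by
  have hL_nonneg (y : EuclideanSpace ℝ (Fin n)) : 0 ≤ L y :=
    (hα₁.nonneg (norm_nonneg y)).trans (hL y).1
  have hL_zero : L 0 = 0 :=
    le_antisymm (by simpa [hα₂.2.2.1] using (hL 0).2) (hL_nonneg 0)
  have h_nonneg (x y : EuclideanSpace ℝ (Fin n)) :
      0 ≤ L y + ‖y - x‖ ^ 2 / (2 * lam ^ 2) :=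
    add_nonneg (hL_nonneg y) (by positivity)
  refine ⟨le_antisymm ?_ (le_ciInf (h_nonneg 0)), fun x hx => ?_⟩
  · refine (ciInf_le ⟨0, Set.forall_mem_range.2 (h_nonneg 0)⟩ 0).trans_eq ?_
    simp [hL_zero]
  · have hx' : 0 < ‖x‖ / 2 := half_pos (norm_pos_iff.2 hx)
    have h_quad : 0 < (‖x‖ / 2) ^ 2 / (2 * lam ^ 2) := by positivity
    refine (lt_min (hα₁.pos hx') h_quad).trans_le (le_ciInf fun y => ?_)
    rcases le_total (‖x‖ / 2) ‖y‖ with hy | hy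
    · calc min (α₁ (‖x‖ / 2)) ((‖x‖ / 2) ^ 2 / (2 * lam ^ 2))
          ≤ α₁ (‖x‖ / 2) := min_le_left _ _
        _ ≤ α₁ ‖y‖ := hα₁.2.1.monotoneOn hx'.le (norm_nonneg y) hy
        _ ≤ L y := (hL y).1
        _ ≤ L y + ‖y - x‖ ^ 2 / (2 * lam ^ 2) := le_add_of_nonneg_right (by positivity)
    · have h_dist : ‖x‖ / 2 ≤ ‖y - x‖ := by
        linarith [norm_sub_norm_le x y, norm_sub_rev x y]
      calc min (α₁ (‖x‖ / 2)) ((‖x‖ / 2) ^ 2 / (2 * lam ^ 2))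
          ≤ (‖x‖ / 2) ^ 2 / (2 * lam ^ 2) := min_le_right _ _
        _ ≤ ‖y - x‖ ^ 2 / (2 * lam ^ 2) := by gcongr
        _ ≤ L y + ‖y - x‖ ^ 2 / (2 * lam ^ 2) := le_add_of_nonneg_left (hL_nonneg y)
end

section
/- Let n ∈ ℕ, λ > 0, let α₁ be a class-𝒦∞ function, and let L : ℝⁿ → ℝ satisfy L(x) ≥ α₁(‖x‖) for all x ∈ ℝⁿ. Define L_λ(x) := inf_{y ∈ ℝⁿ} (L(y) + ‖y − x‖²/(2λ²)). Then L_λ is radially unbounded: for every c ∈ ℝ the sublevel set {x ∈ ℝⁿ : L_λ(x) ≤ c} is bounded (equivalently, L_λ(x) → ∞ as ‖x‖ → ∞). -/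
/-- The Moreau envelope `L_λ(x) = inf_y (L(y) + ‖y − x‖²/(2λ²))` of a
function bounded below by a `𝒦∞` function of the norm is radially unbounded: every
sublevel set is bounded. -/
theorem moreau_envelope_radially_unbounded (n : ℕ) (lam : ℝ) (hlam : 0 < lam)
    (α₁ : ℝ → ℝ) (hα₁ : IsKInfty α₁)
    (L : EuclideanSpace ℝ (Fin n) → ℝ)
    (hL : ∀ x, α₁ ‖x‖ ≤ L x) :
    ∀ c : ℝ, Bornology.IsBounded
      {x : EuclideanSpace ℝ (Fin n) |
        (⨅ y : EuclideanSpace ℝ (Fin n), (L y + ‖y - x‖ ^ 2 / (2 * lam ^ 2))) ≤ c} := by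
  intro c
  obtain ⟨-, hmono, hzero, htop⟩ := hα₁
  obtain ⟨R, hR⟩ := Filter.eventually_atTop.1 (htop.eventually_ge_atTop (c + 1))
  refine isBounded_iff_forall_norm_le.2 ⟨R + √((c + 1) * (2 * lam ^ 2)), fun x hx => ?_⟩
  obtain ⟨y, hy⟩ := exists_lt_of_ciInf_lt (lt_of_le_of_lt hx (lt_add_one c))
  have hα : 0 ≤ α₁ ‖y‖ := by
    simpa only [hzero] using hmono.monotoneOn Set.self_mem_Ici (norm_nonneg y) (norm_nonneg y)
  have hLy := hL y
  have hquad : 0 ≤ ‖y - x‖ ^ 2 / (2 * lam ^ 2) := by positivity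
  have hyR : ‖y‖ ≤ R := by
    by_contra! h
    linarith [hR _ h.le]
  have hdist : ‖y - x‖ ≤ √((c + 1) * (2 * lam ^ 2)) := by
    refine Real.le_sqrt_of_sq_le ((div_le_iff₀ (by positivity)).1 ?_)
    linarith
  linarith [norm_le_norm_add_norm_sub y x]
end

section
/- Let E be a real inner product space, L : E → ℝ, λ > 0, x ∈ E, and let x* ∈ E be a proximal point of x, i.e., L(x*) + ‖x* − x‖²/(2λ²) ≤ L(y) + ‖y − x‖²/(2λ²) for all y ∈ E. Set ζ := (x − x*)/λ². Then for every direction v ∈ E, ⟨ζ, v⟩ ≤ 𝒟_v L(x*), where 𝒟_v L(x*) := liminf_{t → 0⁺, w → v} (L(x* + t·w) − L(x*))/t is the lower directional Dini derivative of L at x* in direction v. -/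
open scoped RealInnerProductSpace

theorem inner_sub_le_difference_quotient_of_prox {E : Type*} [NormedAddCommGroup E]
    [InnerProductSpace ℝ E] {L : E → ℝ} {lam : ℝ} (hlam : 0 < lam) {x xs : E}
    (hmin : ∀ y : E, L xs + ‖xs - x‖ ^ 2 / (2 * lam ^ 2) ≤ L y + ‖y - x‖ ^ 2 / (2 * lam ^ 2))
    {t : ℝ} (ht : 0 < t) (w : E) :
    ⟪(lam ^ 2)⁻¹ • (x - xs), w⟫ - t * (‖w‖ ^ 2 / (2 * lam ^ 2)) ≤
      (L (xs + t • w) - L xs) / t := by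
  have hexpand : ‖xs + t • w - x‖ ^ 2 =
      ‖xs - x‖ ^ 2 - 2 * t * ⟪x - xs, w⟫ + t ^ 2 * ‖w‖ ^ 2 := by
    rw [show xs + t • w - x = t • w - (x - xs) by abel, norm_sub_sq_real, norm_smul, mul_pow,
      Real.norm_eq_abs, sq_abs, real_inner_smul_left, real_inner_comm, norm_sub_rev x xs]
    ring
  have h := hmin (xs + t • w)
  rw [hexpand] at h
  rw [le_div_iff₀ ht, real_inner_smul_left]
  have heq : (‖xs - x‖ ^ 2 - 2 * t * ⟪x - xs, w⟫ + t ^ 2 * ‖w‖ ^ 2) / (2 * lam ^ 2) =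
      ‖xs - x‖ ^ 2 / (2 * lam ^ 2) -
        ((lam ^ 2)⁻¹ * ⟪x - xs, w⟫ - t * (‖w‖ ^ 2 / (2 * lam ^ 2))) * t := by
    field_simp
    ring
  linarith

/-- Proximal subgradient inequality: if `x*` minimizes
`y ↦ L(y) + ‖y − x‖²/(2λ²)` and `ζ := (x − x*)/λ²`, then for every direction `v`,
`⟨ζ, v⟩ ≤ 𝒟_v L(x*)`, where `𝒟_v L(x*)` is the lower directional Dini derivative,
i.e. the liminf of the difference quotients along `t → 0⁺`, `w → v`. -/
theorem prox_subgradient_le_dini {E : Type*} [NormedAddCommGroup E] [InnerProductSpace ℝ E]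
    (L : E → ℝ) (lam : ℝ) (hlam : 0 < lam) (x xs : E)
    (hmin : ∀ y : E, L xs + ‖xs - x‖ ^ 2 / (2 * lam ^ 2) ≤ L y + ‖y - x‖ ^ 2 / (2 * lam ^ 2)) :
    ∀ v : E,
      ((⟪(lam ^ 2)⁻¹ • (x - xs), v⟫ : ℝ) : EReal) ≤
        Filter.liminf
          (fun p : ℝ × E => (((L (xs + p.1 • p.2) - L xs) / p.1 : ℝ) : EReal))
          ((nhdsWithin (0 : ℝ) (Set.Ioi 0)) ×ˢ (nhds v)) := by
  intro v
  have hcont : Continuous fun p : ℝ × E =>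
      ((⟪(lam ^ 2)⁻¹ • (x - xs), p.2⟫ - p.1 * (‖p.2‖ ^ 2 / (2 * lam ^ 2)) : ℝ) : EReal) :=
    continuous_coe_real_ereal.comp (by fun_prop)
  have hle : nhdsWithin (0 : ℝ) (Set.Ioi 0) ×ˢ nhds v ≤ nhds ((0 : ℝ), v) := by
    rw [nhds_prod_eq]
    exact Filter.prod_mono nhdsWithin_le_nhds le_rfl
  have hlim := ((hcont.tendsto (0, v)).mono_left hle).liminf_eq
  simp only [zero_mul, sub_zero] at hlim
  rw [← hlim]
  refine Filter.liminf_le_liminf ?_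
  have hpos : ∀ᶠ p : ℝ × E in nhdsWithin (0 : ℝ) (Set.Ioi 0) ×ˢ nhds v, 0 < p.1 :=
    Filter.tendsto_fst.eventually self_mem_nhdsWithin
  filter_upwards [hpos] with p hp
  exact EReal.coe_le_coe_iff.2 (inner_sub_le_difference_quotient_of_prox hlam hmin hp p.2)
end

section
/- Let n ∈ ℕ, λ > 0, let α₂ be a class-𝒦∞ function, let K ≥ 0, and let L : ℝⁿ → ℝ be nonnegative with L(z) ≤ α₂(‖z‖) for all z. Fix x ∈ ℝⁿ and let x* be a proximal point of x, i.e., a minimizer of y ↦ L(y) + ‖y − x‖²/(2λ²). Define L_λ(x) := inf_{y} (L(y) + ‖y − x‖²/(2λ²)). Suppose L is Lipschitz continuous with constant K on the closed ball of radius ‖x‖ + λ√(2 α₂(‖x‖)) centered at the origin. Then ‖x − x*‖²/λ² = 2 (L_λ(x) − L(x*)) ≤ 2 (L(x) − L(x*)) ≤ 2 K λ √(2 α₂(‖x‖)). -/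
open scoped NNReal

/-- A proximal point attains the Moreau envelope. -/
theorem moreauEnvelope_eq_of_isProximalPoint {E : Type*} [NormedAddCommGroup E] {L : E → ℝ}
    {lam : ℝ} {x xs : E}
    (hmin : ∀ y, L xs + ‖xs - x‖ ^ 2 / (2 * lam ^ 2) ≤ L y + ‖y - x‖ ^ 2 / (2 * lam ^ 2)) :
    ⨅ y, (L y + ‖y - x‖ ^ 2 / (2 * lam ^ 2)) = L xs + ‖xs - x‖ ^ 2 / (2 * lam ^ 2) :=
  IsLeast.csInf_eq ⟨⟨xs, rfl⟩, Set.forall_mem_range.2 hmin⟩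

/-- The distance from `x` to a proximal point of a nonnegative function `L` is at most
`λ√(2L(x))`. -/
theorem norm_sub_le_of_isProximalPoint {E : Type*} [NormedAddCommGroup E] {L : E → ℝ}
    {lam : ℝ} (hlam : 0 < lam) {x xs : E} (hxs : 0 ≤ L xs)
    (hmin : ∀ y, L xs + ‖xs - x‖ ^ 2 / (2 * lam ^ 2) ≤ L y + ‖y - x‖ ^ 2 / (2 * lam ^ 2)) :
    ‖xs - x‖ ≤ lam * Real.sqrt (2 * L x) := by
  have h : L xs + ‖xs - x‖ ^ 2 / (2 * lam ^ 2) ≤ L x := by simpa using hmin x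
  have h' : ‖xs - x‖ ^ 2 ≤ L x * (2 * lam ^ 2) :=
    (div_le_iff₀ (by positivity)).1 (by linarith)
  have hsqrt : ‖xs - x‖ / lam ≤ Real.sqrt (2 * L x) := by
    apply Real.le_sqrt_of_sq_le
    rw [div_pow, div_le_iff₀ (by positivity)]
    linarith
  rwa [div_le_iff₀' hlam] at hsqrt

/-- Bound on the proximal step: for a nonnegative function `L ≤ α₂(‖·‖)`
that is `K`-Lipschitz on the closed ball of radius `‖x‖ + λ√(2α₂(‖x‖))`, any proximal point
`x*` of `x` satisfies
`‖x − x*‖²/λ² = 2(L_λ(x) − L(x*)) ≤ 2(L(x) − L(x*)) ≤ 2Kλ√(2α₂(‖x‖))`. -/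
theorem prox_step_bound (n : ℕ) (lam : ℝ) (hlam : 0 < lam) (α₂ : ℝ → ℝ)
    (hα₂ : IsKInfty α₂) (K : ℝ≥0)
    (L : EuclideanSpace ℝ (Fin n) → ℝ) (hL0 : ∀ z, 0 ≤ L z) (hLub : ∀ z, L z ≤ α₂ ‖z‖)
    (x xs : EuclideanSpace ℝ (Fin n))
    (hmin : ∀ y : EuclideanSpace ℝ (Fin n),
      L xs + ‖xs - x‖ ^ 2 / (2 * lam ^ 2) ≤ L y + ‖y - x‖ ^ 2 / (2 * lam ^ 2))
    (hLip : LipschitzOnWith K L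
      (Metric.closedBall (0 : EuclideanSpace ℝ (Fin n))
        (‖x‖ + lam * Real.sqrt (2 * α₂ ‖x‖)))) :
    ‖x - xs‖ ^ 2 / lam ^ 2 =
        2 * ((⨅ y : EuclideanSpace ℝ (Fin n), (L y + ‖y - x‖ ^ 2 / (2 * lam ^ 2))) - L xs) ∧
    2 * ((⨅ y : EuclideanSpace ℝ (Fin n), (L y + ‖y - x‖ ^ 2 / (2 * lam ^ 2))) - L xs) ≤
        2 * (L x - L xs) ∧
    2 * (L x - L xs) ≤ 2 * K * lam * Real.sqrt (2 * α₂ ‖x‖) := by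
  have hx : L xs + ‖xs - x‖ ^ 2 / (2 * lam ^ 2) ≤ L x := by simpa using hmin x
  have hstep : ‖xs - x‖ ≤ lam * Real.sqrt (2 * α₂ ‖x‖) :=
    (norm_sub_le_of_isProximalPoint hlam (hL0 xs) hmin).trans <| by
      gcongr
      exact hLub x
  rw [moreauEnvelope_eq_of_isProximalPoint hmin]
  refine ⟨?_, by linarith, ?_⟩
  · rw [norm_sub_rev]
    field_simp
    ring
  · have hxball : x ∈ Metric.closedBall (0 : EuclideanSpace ℝ (Fin n))
        (‖x‖ + lam * Real.sqrt (2 * α₂ ‖x‖)) := by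
      rw [mem_closedBall_zero_iff]
      exact le_add_of_nonneg_right (by positivity)
    have hxsball : xs ∈ Metric.closedBall (0 : EuclideanSpace ℝ (Fin n))
        (‖x‖ + lam * Real.sqrt (2 * α₂ ‖x‖)) := by
      rw [mem_closedBall_zero_iff]
      linarith [norm_le_norm_add_norm_sub' xs x]
    have hL : L x - L xs ≤ K * ‖xs - x‖ := by
      have h := hLip.dist_le_mul x hxball xs hxsball
      rw [Real.dist_eq, dist_eq_norm, norm_sub_rev x xs] at h
      exact (le_abs_self _).trans h
    have hK : (K : ℝ) * ‖xs - x‖ ≤ K * (lam * Real.sqrt (2 * α₂ ‖x‖)) := by gcongr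
    linarith
end

section
/- Let n ∈ ℕ, let U be a nonempty set, f : ℝⁿ × U → ℝⁿ, λ > 0, η ≥ 0, and let α₂, α₃ be class-𝒦∞ functions. Let L : ℝⁿ → ℝ be nonnegative with L(z) ≤ α₂(‖z‖) for all z. Fix x ∈ ℝⁿ and let x* be a proximal point of x, i.e., a minimizer of y ↦ L(y) + ‖y − x‖²/(2λ²); set ζ := (x − x*)/λ². Assume the control Lyapunov decay condition at x*: inf over v in the closed convex hull of {f(x*, u′) : u′ ∈ U} of 𝒟_v L(x*) is ≤ −α₃(‖x*‖), where 𝒟_v L(x*) := liminf_{t → 0⁺, w → v} (L(x* + t·w) − L(x*))/t. Let u ∈ U satisfy ⟨ζ, f(x*, u)⟩ ≤ inf_{u′ ∈ U} ⟨ζ, f(x*, u′)⟩ + η. Then ⟨ζ, f(x*, u)⟩ ≤ −α₃( max(0, ‖x‖ − λ√(2 α₂(‖x‖))) ) + η. -/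
open scoped RealInnerProductSpace

/-- A proximal point `xs` of `x` makes `(x - xs) / c²` a proximal subgradient: it bounds the lower
Dini derivatives of `L` at `xs` from below. -/
theorem inner_le_liminf_of_isProx {E : Type*} [NormedAddCommGroup E] [InnerProductSpace ℝ E]
    {L : E → ℝ} {c : ℝ} (hc : 0 < c) {x xs : E}
    (hmin : ∀ y, L xs + ‖xs - x‖ ^ 2 / (2 * c ^ 2) ≤ L y + ‖y - x‖ ^ 2 / (2 * c ^ 2)) (v : E) :
    ((⟪(c ^ 2)⁻¹ • (x - xs), v⟫ : ℝ) : EReal) ≤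
      Filter.liminf (fun p : ℝ × E => (((L (xs + p.1 • p.2) - L xs) / p.1 : ℝ) : EReal))
        ((nhdsWithin (0 : ℝ) (Set.Ioi 0)) ×ˢ (nhds v)) := by
  have hcont : Continuous fun p : ℝ × E =>
      ((⟪(c ^ 2)⁻¹ • (x - xs), p.2⟫ - p.1 * ‖p.2‖ ^ 2 / (2 * c ^ 2) : ℝ) : EReal) :=
    continuous_coe_real_ereal.comp (by fun_prop)
  have hle : (nhdsWithin (0 : ℝ) (Set.Ioi 0)) ×ˢ (nhds v) ≤ nhds ((0 : ℝ), v) := by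
    rw [nhds_prod_eq]
    exact Filter.prod_mono_left _ nhdsWithin_le_nhds
  have hlim := (hcont.tendsto ((0 : ℝ), v)).mono_left hle
  have hval := hlim.liminf_eq
  simp only [zero_mul, zero_div, sub_zero] at hval
  rw [← hval]
  refine Filter.liminf_le_liminf ?_
  have hpos : ∀ᶠ p : ℝ × E in (nhdsWithin (0 : ℝ) (Set.Ioi 0)) ×ˢ (nhds v), 0 < p.1 :=
    Filter.tendsto_fst.eventually self_mem_nhdsWithin
  filter_upwards [hpos] with p hp
  rw [EReal.coe_le_coe_iff, le_div_iff₀ hp]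
  have hy := hmin (xs + p.1 • p.2)
  have hexp : ‖xs + p.1 • p.2 - x‖ ^ 2 =
      ‖xs - x‖ ^ 2 - 2 * (p.1 * ⟪x - xs, p.2⟫) + p.1 ^ 2 * ‖p.2‖ ^ 2 := by
    rw [show xs + p.1 • p.2 - x = (xs - x) + p.1 • p.2 by abel, norm_add_sq_real,
      inner_smul_right, norm_smul, mul_pow, Real.norm_eq_abs, sq_abs, ← neg_sub x xs,
      inner_neg_left]
    ring
  rw [hexp] at hy
  have hsplit : (⟪(c ^ 2)⁻¹ • (x - xs), p.2⟫ - p.1 * ‖p.2‖ ^ 2 / (2 * c ^ 2)) * p.1 =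
      ‖xs - x‖ ^ 2 / (2 * c ^ 2) -
        (‖xs - x‖ ^ 2 - 2 * (p.1 * ⟪x - xs, p.2⟫) + p.1 ^ 2 * ‖p.2‖ ^ 2) / (2 * c ^ 2) := by
    rw [real_inner_smul_left]
    field_simp
    ring
  linarith

/-- A lower bound for a linear functional on a set persists on its closed convex hull. -/
theorem le_inner_of_mem_closure_convexHull {E : Type*} [NormedAddCommGroup E]
    [InnerProductSpace ℝ E] {s : Set E} {a : ℝ} {z : E} (h : ∀ w ∈ s, a ≤ ⟪z, w⟫)
    {v : E} (hv : v ∈ closure (convexHull ℝ s)) : a ≤ ⟪z, v⟫ := by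
  have hconv : Convex ℝ {w : E | a ≤ ⟪z, w⟫} :=
    convex_halfSpace_ge (innerₛₗ ℝ z).isLinear a
  have hclosed : IsClosed {w : E | a ≤ ⟪z, w⟫} := isClosed_le (by fun_prop) (by fun_prop)
  exact closure_minimal (convexHull_min h hconv) hclosed hv

/-- A proximal point of `x` lies within `c √(2 a)` of `x` whenever `L x ≤ a`. -/
theorem norm_sub_le_of_isProx {E : Type*} [NormedAddCommGroup E] {L : E → ℝ} {c a : ℝ}
    (hc : 0 < c) {x xs : E} (h0 : 0 ≤ L xs) (ha : L x ≤ a)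
    (hmin : ∀ y, L xs + ‖xs - x‖ ^ 2 / (2 * c ^ 2) ≤ L y + ‖y - x‖ ^ 2 / (2 * c ^ 2)) :
    ‖xs - x‖ ≤ c * Real.sqrt (2 * a) := by
  have hx := hmin x
  simp only [sub_self, norm_zero, ne_eq, OfNat.ofNat_ne_zero, not_false_eq_true, zero_pow,
    zero_div, add_zero] at hx
  have hsq : ‖xs - x‖ ^ 2 / (2 * c ^ 2) ≤ a := by linarith
  rw [div_le_iff₀ (by positivity)] at hsq
  rw [mul_comm, ← div_le_iff₀ hc]
  refine Real.le_sqrt_of_sq_le ?_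
  rw [div_pow, div_le_iff₀ (by positivity)]
  linarith

/-- Decay bound for the proximal control: under the control Lyapunov decay
condition at the proximal point `x*` of `x` (infimum over the closed convex hull of
`{f(x*,u') : u' ∈ U}` of the lower Dini derivative of `L` is at most `−α₃(‖x*‖)`),
any `η`-approximate minimizer `u` of `u' ↦ ⟨ζ, f(x*, u')⟩`, with `ζ = (x − x*)/λ²`,
satisfies `⟨ζ, f(x*, u)⟩ ≤ −α₃(max(0, ‖x‖ − λ√(2α₂(‖x‖)))) + η`. -/
theorem prox_control_decay (n : ℕ) (U : Type*) [Nonempty U]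
    (f : EuclideanSpace ℝ (Fin n) → U → EuclideanSpace ℝ (Fin n))
    (lam η : ℝ) (hlam : 0 < lam) (hη : 0 ≤ η)
    (α₂ α₃ : ℝ → ℝ) (hα₂ : IsKInfty α₂) (hα₃ : IsKInfty α₃)
    (L : EuclideanSpace ℝ (Fin n) → ℝ) (hL0 : ∀ z, 0 ≤ L z) (hLub : ∀ z, L z ≤ α₂ ‖z‖)
    (x xs : EuclideanSpace ℝ (Fin n))
    (hmin : ∀ y : EuclideanSpace ℝ (Fin n),
      L xs + ‖xs - x‖ ^ 2 / (2 * lam ^ 2) ≤ L y + ‖y - x‖ ^ 2 / (2 * lam ^ 2))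
    (hdecay : (⨅ v ∈ closure (convexHull ℝ (Set.range (f xs))),
        Filter.liminf
          (fun p : ℝ × EuclideanSpace ℝ (Fin n) =>
            (((L (xs + p.1 • p.2) - L xs) / p.1 : ℝ) : EReal))
          ((nhdsWithin (0 : ℝ) (Set.Ioi 0)) ×ˢ (nhds v))) ≤ ((-α₃ ‖xs‖ : ℝ) : EReal))
    (u : U)
    (hu : ∀ u' : U, ⟪(lam ^ 2)⁻¹ • (x - xs), f xs u⟫ ≤ ⟪(lam ^ 2)⁻¹ • (x - xs), f xs u'⟫ + η) :
    ⟪(lam ^ 2)⁻¹ • (x - xs), f xs u⟫ ≤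
      -α₃ (max 0 (‖x‖ - lam * Real.sqrt (2 * α₂ ‖x‖))) + η := by
  have hprox :
      ((⟪(lam ^ 2)⁻¹ • (x - xs), f xs u⟫ - η : ℝ) : EReal) ≤ ((-α₃ ‖xs‖ : ℝ) : EReal) := by
    refine le_trans (le_iInf₂ fun v hv => ?_) hdecay
    refine le_trans (EReal.coe_le_coe_iff.2 ?_) (inner_le_liminf_of_isProx hlam hmin v)
    refine le_inner_of_mem_closure_convexHull ?_ hv
    rintro _ ⟨u', rfl⟩
    linarith [hu u']
  rw [EReal.coe_le_coe_iff] at hprox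
  have hdist := norm_sub_le_of_isProx hlam (hL0 xs) (hLub x) hmin
  have htri : ‖x‖ - ‖xs‖ ≤ ‖xs - x‖ := norm_sub_rev x xs ▸ norm_sub_norm_le x xs
  have hα : α₃ (max 0 (‖x‖ - lam * Real.sqrt (2 * α₂ ‖x‖))) ≤ α₃ ‖xs‖ :=
    hα₃.2.1.monotoneOn (Set.mem_Ici.2 (le_max_left _ _)) (norm_nonneg xs)
      (max_le (norm_nonneg xs) (by linarith))
  linarith
end

section
/- Let n ∈ ℕ, let α₁, α₂ be class-𝒦∞ functions, and let V : ℝⁿ → ℝ satisfy α₁(‖x‖) ≤ V(x) ≤ α₂(‖x‖) for all x ∈ ℝⁿ. Let (x_k)_{k∈ℕ} be a sequence in ℝⁿ, let 0 < ρ ≤ R ≤ R* be such that α₂(R) ≤ α₁(R*), and let Δ > 0 be such that for every l ∈ ℕ: ρ ≤ ‖x_l‖ ≤ R* implies V(x_{l+1}) − V(x_l) ≤ −Δ. Then for every k with ‖x_k‖ ≤ R there exists l ≥ k with ‖x_l‖ < ρ. -/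
/-- Attraction lemma (deterministic core): if
`α₁(‖x‖) ≤ V(x) ≤ α₂(‖x‖)`, `0 < ρ ≤ R ≤ R*`, `α₂(R) ≤ α₁(R*)`, and `V` decreases by at
least `Δ > 0` along the sequence whenever `ρ ≤ ‖x_l‖ ≤ R*`, then any state with `‖x_k‖ ≤ R`
eventually enters the ball of radius `ρ`. -/
theorem lyapunov_attraction (n : ℕ) (α₁ α₂ : ℝ → ℝ)
    (hα₁ : IsKInfty α₁) (hα₂ : IsKInfty α₂)
    (V : EuclideanSpace ℝ (Fin n) → ℝ)
    (hV : ∀ x, α₁ ‖x‖ ≤ V x ∧ V x ≤ α₂ ‖x‖)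
    (x : ℕ → EuclideanSpace ℝ (Fin n))
    (ρ R Rs : ℝ) (hρ : 0 < ρ) (hρR : ρ ≤ R) (hRRs : R ≤ Rs) (hα : α₂ R ≤ α₁ Rs)
    (Δ : ℝ) (hΔ : 0 < Δ)
    (hdec : ∀ l : ℕ, ρ ≤ ‖x l‖ → ‖x l‖ ≤ Rs → V (x (l + 1)) - V (x l) ≤ -Δ) :
    ∀ k : ℕ, ‖x k‖ ≤ R → ∃ l : ℕ, k ≤ l ∧ ‖x l‖ < ρ := by
  intro k hk
  by_contra! hout
  have hR0 : 0 ≤ R := (hρ.trans_le hρR).le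
  have norm_le : ∀ y, V y ≤ α₂ R → ‖y‖ ≤ Rs := fun y hy =>
    (hα₁.2.1.le_iff_le (norm_nonneg y) (hR0.trans hRRs)).1 (((hV y).1.trans hy).trans hα)
  have V_le : ∀ j : ℕ, V (x (k + j)) ≤ α₂ R - j * Δ := by
    intro j
    induction j with
    | zero =>
      have h := (hα₂.2.1.le_iff_le (norm_nonneg (x k)) hR0).2 hk
      simpa using (hV (x k)).2.trans h
    | succ j ih =>
      have hj : 0 ≤ (j : ℝ) * Δ := by positivity
      have h := hdec (k + j) (hout _ (Nat.le_add_right k j)) (norm_le _ (by linarith))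
      rw [add_assoc] at h
      push_cast
      linarith
  have V_nonneg : ∀ y, 0 ≤ V y := fun y => by
    have h := hα₁.2.1.monotoneOn Set.self_mem_Ici (norm_nonneg y) (norm_nonneg y)
    rw [hα₁.2.2.1] at h
    exact h.trans (hV y).1
  obtain ⟨N, hN⟩ := exists_nat_gt (α₂ R / Δ)
  rw [div_lt_iff₀ hΔ] at hN
  linarith [V_le N, V_nonneg (x (k + N))]
end

section
/- Let n ∈ ℕ, let α₁, α₂ be class-𝒦∞ functions, and let V : ℝⁿ → ℝ satisfy α₁(‖x‖) ≤ V(x) ≤ α₂(‖x‖) for all x ∈ ℝⁿ. Let (x_k)_{k∈ℕ} be a sequence in ℝⁿ and let 0 ≤ r < R_y be numbers such that: (a) for every l, ‖x_l‖ ≤ r implies ‖x_{l+1}‖ ≤ R_y; and (b) for every l, if r < ‖x_l‖ and V(x_l) ≤ α₂(R_y), then V(x_{l+1}) ≤ V(x_l). Suppose there exists N with ‖x_N‖ ≤ R_y. Then for every l ≥ N: α₁(‖x_l‖) ≤ α₂(R_y). -/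
/-- Ultimate boundedness lemma (deterministic core): if
`α₁(‖x‖) ≤ V(x) ≤ α₂(‖x‖)`, `0 ≤ r < R_y`, (a) `‖x_l‖ ≤ r` implies `‖x_{l+1}‖ ≤ R_y`,
(b) `r < ‖x_l‖` together with `V(x_l) ≤ α₂(R_y)` implies `V(x_{l+1}) ≤ V(x_l)`, and
`‖x_N‖ ≤ R_y` for some `N`, then `α₁(‖x_l‖) ≤ α₂(R_y)` for all `l ≥ N`. -/
theorem lyapunov_ultimate_boundedness (n : ℕ) (α₁ α₂ : ℝ → ℝ)
    (hα₁ : IsKInfty α₁) (hα₂ : IsKInfty α₂)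
    (V : EuclideanSpace ℝ (Fin n) → ℝ)
    (hV : ∀ x, α₁ ‖x‖ ≤ V x ∧ V x ≤ α₂ ‖x‖)
    (x : ℕ → EuclideanSpace ℝ (Fin n))
    (r Ry : ℝ) (hr : 0 ≤ r) (hrRy : r < Ry)
    (ha : ∀ l : ℕ, ‖x l‖ ≤ r → ‖x (l + 1)‖ ≤ Ry)
    (hb : ∀ l : ℕ, r < ‖x l‖ → V (x l) ≤ α₂ Ry → V (x (l + 1)) ≤ V (x l))
    (N : ℕ) (hN : ‖x N‖ ≤ Ry) :
    ∀ l : ℕ, N ≤ l → α₁ ‖x l‖ ≤ α₂ Ry := by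
  have V_le_of_norm_le (y : EuclideanSpace ℝ (Fin n)) (hy : ‖y‖ ≤ Ry) : V y ≤ α₂ Ry :=
    (hV y).2.trans (hα₂.2.1.monotoneOn (norm_nonneg y) (hr.trans hrRy.le) hy)
  intro l hl
  refine (hV (x l)).1.trans ?_
  induction l, hl using Nat.le_induction with
  | base => exact V_le_of_norm_le _ hN
  | succ k _ ih =>
    rcases le_or_gt ‖x k‖ r with hk | hk
    · exact V_le_of_norm_le _ (ha k hk)
    · exact (hb k hk ih).trans ih
end

section
/- Let a ≤ b be reals and let ξ, χ : [a,b] → [0,∞) be continuous functions such that ξ(t)² ≤ 2 ∫_a^t ξ(τ) χ(τ) dτ for all t ∈ [a,b]. Then ξ(t) ≤ 2 ∫_a^t χ(τ) dτ for all t ∈ [a,b]. -/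
/-- Bihari-type integral inequality: if `ξ, χ : [a,b] → [0,∞)` are
continuous and `ξ(t)² ≤ 2 ∫_a^t ξ(τ) χ(τ) dτ` on `[a,b]`, then
`ξ(t) ≤ 2 ∫_a^t χ(τ) dτ` on `[a,b]`. -/
theorem bihari_sqrt_bound (a b : ℝ) (hab : a ≤ b) (ξ χ : ℝ → ℝ)
    (hξc : ContinuousOn ξ (Set.Icc a b)) (hχc : ContinuousOn χ (Set.Icc a b))
    (hξ0 : ∀ t ∈ Set.Icc a b, 0 ≤ ξ t) (hχ0 : ∀ t ∈ Set.Icc a b, 0 ≤ χ t)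
    (h : ∀ t ∈ Set.Icc a b, ξ t ^ 2 ≤ 2 * ∫ τ in a..t, ξ τ * χ τ) :
    ∀ t ∈ Set.Icc a b, ξ t ≤ 2 * ∫ τ in a..t, χ τ := by
  intro t ht
  have hsub : Set.Icc a t ⊆ Set.Icc a b := Set.Icc_subset_Icc_right ht.2
  obtain ⟨s, hs, hmax⟩ := isCompact_Icc.exists_isMaxOn (Set.nonempty_Icc.2 ht.1) (hξc.mono hsub)
  have hst : Set.Icc a s ⊆ Set.Icc a t := Set.Icc_subset_Icc_right hs.2
  have hχt : IntervalIntegrable χ MeasureTheory.volume a t :=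
    (hχc.mono hsub).intervalIntegrable_of_Icc ht.1
  have hχs : IntervalIntegrable χ MeasureTheory.volume a s :=
    (hχc.mono (hst.trans hsub)).intervalIntegrable_of_Icc hs.1
  have hξχ : IntervalIntegrable (fun τ => ξ τ * χ τ) MeasureTheory.volume a s :=
    ((hξc.mul hχc).mono (hst.trans hsub)).intervalIntegrable_of_Icc hs.1
  have hle : ∫ τ in a..s, ξ τ * χ τ ≤ ξ s * ∫ τ in a..s, χ τ := by
    rw [← intervalIntegral.integral_const_mul]
    exact intervalIntegral.integral_mono_on hs.1 hξχ (hχs.const_mul _) fun τ hτ =>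
      mul_le_mul_of_nonneg_right (hmax (hst hτ)) (hχ0 τ (hsub (hst hτ)))
  have hmono : ∫ τ in a..s, χ τ ≤ ∫ τ in a..t, χ τ := by
    rw [← intervalIntegral.integral_add_adjacent_intervals hχs (hχs.symm.trans hχt)]
    exact le_add_of_nonneg_right (intervalIntegral.integral_nonneg hs.2 fun τ hτ =>
      hχ0 τ (hsub ⟨hs.1.trans hτ.1, hτ.2⟩))
  have hnonneg : 0 ≤ ∫ τ in a..t, χ τ :=
    intervalIntegral.integral_nonneg ht.1 fun τ hτ => hχ0 τ (hsub hτ)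
  refine (hmax (Set.right_mem_Icc.2 ht.1) : ξ t ≤ ξ s).trans ?_
  rcases (hξ0 s (hsub hs)).eq_or_lt with h0 | hpos
  · rw [← h0]
    positivity
  · refine le_of_mul_le_mul_left ?_ hpos
    nlinarith [h s (hsub hs), mul_le_mul_of_nonneg_left hmono hpos.le]
end
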